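/- Under Assumptions (A) and (B), the sum ∑_{i=0}^{p−1} ((tr(Q_i))² − E[(tr(Q_i))²]) converges to 0 in probability as n → ∞. -/

import Mathlib

open MeasureTheory ProbabilityTheory Matrix Filter Topology

noncomputable section

/-- The standard Gaussian measure on `ℝ^d` (modeled on `Fin d → ℝ`). -/
def gaussianPi (d : ℕ) : Measure (Fin d → ℝ) :=
  Measure.pi fun _ => gaussianReal 0 1

/-- The Euclidean norm on `Fin n → ℝ`. -/
def euclidNorm {n : ℕ} (x : Fin n → ℝ) : ℝ :=
  Real.sqrt (∑ j, x j ^ 2)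

/-- The uniform distribution on the unit sphere `S^{n-1} ⊆ ℝ^n`, realized as the law of a
normalized standard Gaussian vector. -/
def uniformSphere (n : ℕ) : Measure (Fin n → ℝ) :=
  (gaussianPi n).map fun x => (euclidNorm x)⁻¹ • x

/-- The joint law of `p` independent uniform random directions `u_1, …, u_p` on `S^{n-1}`. -/
def sphereLaw (n p : ℕ) : Measure (Fin p → Fin n → ℝ) :=
  Measure.pi fun _ => uniformSphere n

/-- The `(i+1)`-st sample vector `u_{i+1}` (junk value `0` if `i ≥ p`). -/
def uVec {n p : ℕ} (ω : Fin p → Fin n → ℝ) (i : ℕ) : Fin n → ℝ :=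
  if h : i < p then ω ⟨i, h⟩ else 0

/-- The matrix `B_{(i)} = (b_1, …, b_i)ᵀ` with rows `b_j = A u_j`. -/
def rowMat {n p : ℕ} (A : Matrix (Fin n) (Fin n) ℝ) (ω : Fin p → Fin n → ℝ) (i : ℕ) :
    Matrix (Fin i) (Fin n) ℝ :=
  Matrix.of fun k j => A.mulVec (uVec ω (k : ℕ)) j

/-- The projection matrix `P_i = I_n − B_{(i)}ᵀ (B_{(i)} B_{(i)}ᵀ)⁻¹ B_{(i)}` (with `P_0 = I_n`). -/
def projMat {n p : ℕ} (A : Matrix (Fin n) (Fin n) ℝ) (ω : Fin p → Fin n → ℝ) (i : ℕ) :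
    Matrix (Fin n) (Fin n) ℝ :=
  1 - (rowMat A ω i)ᵀ * (rowMat A ω i * (rowMat A ω i)ᵀ)⁻¹ * rowMat A ω i

/-- The entrywise expectation `E[P_i]` of the projection matrix `P_i`. -/
def meanProj (n p : ℕ) (A : Matrix (Fin n) (Fin n) ℝ) (i : ℕ) :
    Matrix (Fin n) (Fin n) ℝ :=
  Matrix.of fun k l => ∫ ω, projMat A ω i k l ∂(sphereLaw n p)

/-- `T_i = tr(A² E[P_i])`. -/
def Tstat (n p : ℕ) (A : Matrix (Fin n) (Fin n) ℝ) (i : ℕ) : ℝ :=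
  Matrix.trace (A * A * meanProj n p A i)

/-- `Q_i = A P_i A / T_i`. -/
def Qmat {n p : ℕ} (A : Matrix (Fin n) (Fin n) ℝ) (ω : Fin p → Fin n → ℝ) (i : ℕ) :
    Matrix (Fin n) (Fin n) ℝ :=
  (Tstat n p A i)⁻¹ • (A * projMat A ω i * A)

/-- `Z̃_{i+1} = n u_{i+1}ᵀ Q_i u_{i+1} − 1`. -/
def Ztil {n p : ℕ} (A : Matrix (Fin n) (Fin n) ℝ) (ω : Fin p → Fin n → ℝ) (i : ℕ) : ℝ :=
  (n : ℝ) * (uVec ω i ⬝ᵥ (Qmat A ω i).mulVec (uVec ω i)) - 1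

/-- The variance `Var(f) = E[(f − E f)²]` of a real random variable `f` under `μ`. -/
def varInt {α : Type*} [MeasurableSpace α] (μ : Measure α) (f : α → ℝ) : ℝ :=
  ∫ ω, (f ω - ∫ ω', f ω' ∂μ) ^ 2 ∂μ

end


lemma pi_update_mp {ι X : Type*} [Fintype ι] [DecidableEq ι] [MeasurableSpace X]
    (μ : ι → Measure X) [∀ i, IsProbabilityMeasure (μ i)] (j : ι) :
    MeasurePreserving (fun z : (ι → X) × X => Function.update z.1 j z.2)
      ((Measure.pi μ).prod (μ j)) (Measure.pi μ) := by
  have hm : Measurable (fun z : (ι → X) × X => Function.update z.1 j z.2) := by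
    refine measurable_pi_iff.2 fun k => ?_
    by_cases hk : k = j
    · subst hk; simpa using measurable_snd
    · simp only [Function.update_of_ne hk]
      exact (measurable_pi_apply k).comp measurable_fst
  refine ⟨hm, ?_⟩
  symm
  refine Measure.pi_eq fun s hs => ?_
  rw [Measure.map_apply hm (MeasurableSet.univ_pi hs)]
  have : (fun z : (ι → X) × X => Function.update z.1 j z.2) ⁻¹' (Set.univ.pi s)
      = (Set.univ.pi (Function.update s j Set.univ)) ×ˢ s j := by
    ext z
    simp only [Set.mem_preimage, Set.mem_pi, Set.mem_univ, true_implies, Set.mem_prod]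
    constructor
    · intro h
      refine ⟨fun k => ?_, by simpa using h j⟩
      by_cases hk : k = j
      · subst hk; simp
      · simpa [hk] using h k
    · rintro ⟨h1, h2⟩ k
      by_cases hk : k = j
      · subst hk; simpa using h2
      · simpa [hk] using h1 k
  rw [this, Measure.prod_prod, Measure.pi_pi, ← Finset.mul_prod_erase _ _ (Finset.mem_univ j),
    ← Finset.mul_prod_erase Finset.univ (fun i => μ i (s i)) (Finset.mem_univ j)]
  simp only [Function.update_self, measure_univ, one_mul]
  rw [mul_comm]
  congr 1
  refine Finset.prod_congr rfl fun k hk => ?_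
  rw [Function.update_of_ne (Finset.ne_of_mem_erase hk)]

lemma pi_ae_of_update {ι X : Type*} [Fintype ι] [DecidableEq ι] [MeasurableSpace X]
    (μ : ι → Measure X) [∀ i, IsProbabilityMeasure (μ i)] (j : ι) (q : (ι → X) → Prop)
    (hq : MeasurableSet {ω | q ω})
    (h : ∀ᵐ ω ∂(Measure.pi μ), ∀ᵐ x ∂(μ j), q (Function.update ω j x)) :
    ∀ᵐ ω ∂(Measure.pi μ), q ω := by
  have hmp := pi_update_mp μ j
  rw [← hmp.map_eq]
  rw [ae_map_iff hmp.measurable.aemeasurable hq]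
  exact (Measure.ae_prod_iff_ae_ae (hmp.measurable hq)).2 h

lemma bdd_integrable {X : Type*} [MeasurableSpace X] (μ : Measure X) [IsFiniteMeasure μ]
    {f : X → ℝ} (hf : Measurable f) {M : ℝ} (hM : ∀ x, |f x| ≤ M) : Integrable f μ :=
  Integrable.of_bound hf.aestronglyMeasurable M (Eventually.of_forall hM)

lemma pi_integral_update {ι X : Type*} [Fintype ι] [DecidableEq ι] [MeasurableSpace X]
    (μ : ι → Measure X) [∀ i, IsProbabilityMeasure (μ i)] (j : ι) (f : (ι → X) → ℝ)
    (hf : Measurable f) (M : ℝ) (hM : ∀ x, |f x| ≤ M) :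
    ∫ ω, f ω ∂(Measure.pi μ)
      = ∫ ω, (∫ x, f (Function.update ω j x) ∂(μ j)) ∂(Measure.pi μ) := by
  have hmp := pi_update_mp μ j
  conv_lhs => rw [← hmp.map_eq]
  rw [integral_map hmp.measurable.aemeasurable hf.aestronglyMeasurable]
  rw [integral_prod]
  exact bdd_integrable _ (hf.comp hmp.measurable) (M := M) fun x => hM _

lemma var_le {X : Type*} [MeasurableSpace X] (μ : Measure X) [IsProbabilityMeasure μ]
    {f : X → ℝ} (hf : Measurable f) {M : ℝ} (hM : ∀ x, |f x| ≤ M) (c : ℝ) :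
    ∫ x, (f x) ^ 2 ∂μ - (∫ x, f x ∂μ) ^ 2 ≤ ∫ x, (f x - c) ^ 2 ∂μ := by
  have i1 := bdd_integrable μ hf hM
  have i2 : Integrable (fun x => f x ^ 2) μ :=
    bdd_integrable μ (hf.pow_const 2) (M := M ^ 2) fun x => by
      rw [abs_pow]; exact pow_le_pow_left₀ (abs_nonneg _) (hM x) 2
  have : ∫ x, (f x - c) ^ 2 ∂μ = ∫ x, (f x) ^ 2 ∂μ - 2 * c * (∫ x, f x ∂μ) + c ^ 2 := by
    have e : (fun x => (f x - c) ^ 2) = fun x => (f x ^ 2 - 2 * c * f x) + c ^ 2 := by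
      ext x; ring
    have i3 : Integrable (fun x => f x ^ 2 - 2 * c * f x) μ := i2.sub (i1.const_mul _)
    rw [e, integral_add i3 (integrable_const _),
      integral_sub i2 (i1.const_mul _), integral_const_mul]
    simp
  rw [this]
  nlinarith [sq_nonneg ((∫ x, f x ∂μ) - c)]

lemma var_eq {X : Type*} [MeasurableSpace X] (μ : Measure X) [IsProbabilityMeasure μ]
    {f : X → ℝ} (hf : Measurable f) {M : ℝ} (hM : ∀ x, |f x| ≤ M) :
    ∫ x, (f x - ∫ y, f y ∂μ) ^ 2 ∂μ = ∫ x, (f x) ^ 2 ∂μ - (∫ x, f x ∂μ) ^ 2 := by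
  have i1 := bdd_integrable μ hf hM
  have i2 : Integrable (fun x => f x ^ 2) μ :=
    bdd_integrable μ (hf.pow_const 2) (M := M ^ 2) fun x => by
      rw [abs_pow]; exact pow_le_pow_left₀ (abs_nonneg _) (hM x) 2
  generalize hc : ∫ y, f y ∂μ = c
  have e : (fun x => (f x - c) ^ 2) = fun x => (f x ^ 2 - 2 * c * f x) + c ^ 2 := by
    ext x; ring
  have i3 : Integrable (fun x => f x ^ 2 - 2 * c * f x) μ := i2.sub (i1.const_mul _)
  rw [e, integral_add i3 (integrable_const _),
    integral_sub i2 (i1.const_mul _), integral_const_mul, hc]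
  simp
  ring

lemma abs_integral_le_bdd {X : Type*} [MeasurableSpace X] (μ : Measure X) [IsProbabilityMeasure μ]
    {f : X → ℝ} {M : ℝ} (hM : ∀ x, |f x| ≤ M) : |∫ x, f x ∂μ| ≤ M := by
  have := norm_integral_le_of_norm_le_const (μ := μ) (f := f) (C := M) (Eventually.of_forall hM)
  simpa using this

/-- Efron–Stein inequality for bounded functions. -/
lemma efron_stein {X : Type*} [MeasurableSpace X] (μ : Measure X) [IsProbabilityMeasure μ] :
    ∀ (p : ℕ) (f : (Fin p → X) → ℝ) (h : Fin p → (Fin p → X) → ℝ) (M : ℝ),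
      Measurable f → (∀ ω, |f ω| ≤ M) → (∀ j, Measurable (h j)) → (∀ j ω, |h j ω| ≤ M) →
      (∀ j ω x, h j (Function.update ω j x) = h j ω) →
      ∫ ω, (f ω) ^ 2 ∂(Measure.pi fun _ => μ) - (∫ ω, f ω ∂(Measure.pi fun _ => μ)) ^ 2
        ≤ ∑ j, ∫ ω, (f ω - h j ω) ^ 2 ∂(Measure.pi fun _ => μ) := by
  intro p
  induction p with
  | zero =>
    intro f h M hf hM _ _ _
    have : ∀ ω : Fin 0 → X, f ω = f Fin.elim0 := fun ω => congrArg f (Subsingleton.elim _ _)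
    simp [this]
  | succ p ih =>
    intro f h M hf hfM hh hhM hupd
    have hM0 : 0 ≤ M ∨ IsEmpty X := by
      rcases isEmpty_or_nonempty X with hX | ⟨⟨x⟩⟩
      · exact Or.inr hX
      · exact Or.inl ((abs_nonneg _).trans (hfM fun _ => x))
    have hmp := (measurePreserving_piFinSuccAbove (fun _ : Fin (p+1) => μ) 0).symm
    have hcoe : ∀ z, (MeasurableEquiv.piFinSuccAbove (fun _ : Fin (p+1) => X) 0).symm z
        = Fin.cons z.1 z.2 := by
      intro z
      simp [MeasurableEquiv.piFinSuccAbove_symm_apply, Fin.insertNthEquiv]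
    have key : ∀ g : (Fin (p+1) → X) → ℝ, ∫ ω, g ω ∂(Measure.pi fun _ => μ)
        = ∫ z, g (Fin.cons z.1 z.2) ∂(μ.prod (Measure.pi fun _ : Fin p => μ)) := by
      intro g
      rw [← hmp.integral_comp']
      simp only [hcoe]
    have hcons : Measurable (fun z : X × (Fin p → X) => (Fin.cons z.1 z.2 : Fin (p+1) → X)) := by
      have := hmp.measurable
      rwa [show (⇑(MeasurableEquiv.piFinSuccAbove (fun _ : Fin (p+1) => X) 0).symm)
        = fun z => Fin.cons z.1 z.2 from funext hcoe] at this
    have sqb : ∀ {a : ℝ}, |a| ≤ M → |a ^ 2| ≤ M ^ 2 := fun {a} ha => by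
      rw [abs_pow]; exact pow_le_pow_left₀ (abs_nonneg _) ha 2
    have sqb2 : ∀ {a b : ℝ}, |a| ≤ M → |b| ≤ M → |(a - b) ^ 2| ≤ (M + M) ^ 2 :=
      fun {a b} ha hb => by
      rw [abs_pow]; exact pow_le_pow_left₀ (abs_nonneg _) ((abs_sub _ _).trans (add_le_add ha hb)) 2
    set π := (Measure.pi fun _ : Fin p => μ) with hπ
    have key2 : ∀ g : (Fin (p+1) → X) → ℝ, Measurable g → ∀ K, (∀ ω, |g ω| ≤ K) →
        ∫ ω, g ω ∂(Measure.pi fun _ => μ) = ∫ y, ∫ x, g (Fin.cons x y) ∂μ ∂π := by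
      intro g hg K hK
      rw [key, integral_prod_symm]
      exact bdd_integrable _ (hg.comp hcons) (M := K) fun x => hK _
    set F : (Fin p → X) → ℝ := fun y => ∫ x, f (Fin.cons x y) ∂μ with hF
    set H : Fin p → (Fin p → X) → ℝ := fun j y => ∫ x, h j.succ (Fin.cons x y) ∂μ with hH
    have measI : ∀ g : (Fin (p+1) → X) → ℝ, Measurable g →
        Measurable (fun y => ∫ x, g (Fin.cons x y) ∂μ) := by
      intro g hg
      have : StronglyMeasurable (fun z : (Fin p → X) × X => g (Fin.cons z.2 z.1)) :=
        (hg.comp (hcons.comp measurable_swap)).stronglyMeasurable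
      exact this.integral_prod_right.measurable
    have mcons : ∀ y : Fin p → X, Measurable (fun x : X => (Fin.cons x y : Fin (p+1) → X)) :=
      fun y => hcons.comp (measurable_id.prodMk measurable_const)
    have IH := ih F H M (measI f hf) (fun y => abs_integral_le_bdd μ fun x => hfM _)
      (fun j => measI _ (hh _)) (fun j y => abs_integral_le_bdd μ fun x => hhM _ _) (by
        intro j y x'
        simp only [hH]
        congr 1; ext x
        rw [Fin.cons_update, hupd])
    rw [Fin.sum_univ_succ]
    have e1 : ∫ ω, f ω ∂(Measure.pi fun _ => μ) = ∫ y, F y ∂π := key2 f hf M hfM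
    have m2 : Measurable (fun ω => f ω ^ 2) := hf.pow_const 2
    have e2 := key2 (fun ω => f ω ^ 2) m2 (M ^ 2) (fun ω => sqb (hfM ω))
    have m3 : ∀ j, Measurable (fun ω => (f ω - h j ω) ^ 2) := fun j => (hf.sub (hh j)).pow_const 2
    have e3 := fun j => key2 (fun ω => (f ω - h j ω) ^ 2) (m3 j) ((M + M) ^ 2)
      (fun ω => sqb2 (hfM ω) (hhM j ω))
    have iF2 : Integrable (fun y => F y ^ 2) π :=
      bdd_integrable _ ((measI f hf).pow_const 2) (M := M ^ 2)
        fun y => sqb (abs_integral_le_bdd μ fun x => hfM _)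
    have iff2 : Integrable (fun y => ∫ x, f (Fin.cons x y) ^ 2 ∂μ) π :=
      bdd_integrable _ (measI _ m2) (M := M ^ 2)
        fun y => abs_integral_le_bdd μ fun x => sqb (hfM _)
    have i3 : ∀ j, Integrable (fun y => ∫ x, (f (Fin.cons x y) - h j (Fin.cons x y)) ^ 2 ∂μ) π :=
      fun j => bdd_integrable _ (measI _ (m3 j)) (M := (M + M) ^ 2)
        fun y => abs_integral_le_bdd μ fun x => sqb2 (hfM _) (hhM j _)
    have step0 : ∫ y, ∫ x, f (Fin.cons x y) ^ 2 ∂μ ∂π - ∫ y, F y ^ 2 ∂π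
        ≤ ∫ ω, (f ω - h 0 ω) ^ 2 ∂(Measure.pi fun _ => μ) := by
      rw [e3 0, ← integral_sub iff2 iF2]
      refine integral_mono (iff2.sub iF2) (i3 0) fun y => ?_
      rcases isEmpty_or_nonempty X with hX | ⟨⟨x0⟩⟩
      · simp [hF, Measure.eq_zero_of_isEmpty μ]
      have hc : ∀ x, h 0 (Fin.cons x y) = h 0 (Fin.cons x0 y) := by
        intro x
        rw [← hupd 0 (Fin.cons x0 y) x, Fin.update_cons_zero]
      simp only [hc]
      exact var_le μ (hf.comp (mcons y)) (fun x => hfM _) _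
    have stepj : ∀ j : Fin p, ∫ y, (F y - H j y) ^ 2 ∂π
        ≤ ∫ ω, (f ω - h j.succ ω) ^ 2 ∂(Measure.pi fun _ => μ) := by
      intro j
      rw [e3 j.succ]
      refine integral_mono ?_ (i3 _) fun y => ?_
      · exact bdd_integrable _ (((measI f hf).sub (measI _ (hh _))).pow_const 2)
          (M := (M + M) ^ 2) fun y => sqb2 (abs_integral_le_bdd μ fun x => hfM _)
            (abs_integral_le_bdd μ fun x => hhM _ _)
      · have i1 : Integrable (fun x => f (Fin.cons x y)) μ :=
          bdd_integrable _ (hf.comp (mcons y)) fun x => hfM _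
        have i2 : Integrable (fun x => h j.succ (Fin.cons x y)) μ :=
          bdd_integrable _ ((hh _).comp (mcons y)) fun x => hhM _ _
        have := var_le μ (f := fun x => f (Fin.cons x y) - h j.succ (Fin.cons x y)) (M := M + M)
          ((hf.comp (mcons y)).sub ((hh _).comp (mcons y)))
          (fun x => (abs_sub _ _).trans (add_le_add (hfM _) (hhM _ _))) 0
        have v := var_eq μ (f := fun x => f (Fin.cons x y) - h j.succ (Fin.cons x y)) (M := M + M)
          ((hf.comp (mcons y)).sub ((hh _).comp (mcons y)))
          (fun x => (abs_sub _ _).trans (add_le_add (hfM _) (hhM _ _)))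
        have nn : 0 ≤ ∫ x, ((f (Fin.cons x y) - h j.succ (Fin.cons x y)) -
          ∫ x', (f (Fin.cons x' y) - h j.succ (Fin.cons x' y)) ∂μ) ^ 2 ∂μ :=
          integral_nonneg fun x => sq_nonneg _
        have e : F y - H j y = ∫ x, (f (Fin.cons x y) - h j.succ (Fin.cons x y)) ∂μ :=
          (integral_sub i1 i2).symm
        show (F y - H j y) ^ 2 ≤ _
        rw [e]
        linarith
    have := Finset.sum_le_sum (s := Finset.univ) fun j _ => stepj j
    rw [e1, e2]
    linarith


noncomputable def projB {ι : Type*} [Fintype ι] [DecidableEq ι] {n : ℕ}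
    (B : Matrix ι (Fin n) ℝ) : Matrix (Fin n) (Fin n) ℝ :=
  1 - Bᵀ * (B * Bᵀ)⁻¹ * B

section projB
variable {ι : Type*} [Fintype ι] [DecidableEq ι] {n : ℕ} (B : Matrix ι (Fin n) ℝ)

lemma projB_transpose : (projB B)ᵀ = projB B := by
  simp [projB, Matrix.transpose_mul, Matrix.transpose_nonsing_inv, Matrix.mul_assoc]

lemma projB_mul_transpose (h : IsUnit (B * Bᵀ).det) : projB B * Bᵀ = 0 := by
  rw [projB, Matrix.sub_mul, Matrix.mul_assoc, Matrix.mul_assoc,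
    Matrix.nonsing_inv_mul _ h]
  simp

lemma mul_projB (h : IsUnit (B * Bᵀ).det) : B * projB B = 0 := by
  have := congrArg Matrix.transpose (projB_mul_transpose B h)
  simpa [Matrix.transpose_mul, projB_transpose] using this

lemma projB_of_not (h : ¬ IsUnit (B * Bᵀ).det) : projB B = 1 := by
  simp [projB, Matrix.nonsing_inv_apply_not_isUnit _ h]

lemma projB_idem : projB B * projB B = projB B := by
  by_cases h : IsUnit (B * Bᵀ).det
  · conv_lhs => rw [projB, Matrix.sub_mul, Matrix.mul_assoc _ B, ← projB, mul_projB B h]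
    simp
  · simp [projB_of_not B h]

lemma projB_fix (x : Fin n → ℝ) (hx : B *ᵥ x = 0) : projB B *ᵥ x = x := by
  rw [projB, Matrix.sub_mulVec, ← Matrix.mulVec_mulVec, hx]
  simp

lemma projB_unique (h : IsUnit (B * Bᵀ).det) (Q : Matrix (Fin n) (Fin n) ℝ)
    (h1 : Q * Bᵀ = 0) (h2 : ∀ x, B *ᵥ x = 0 → Q *ᵥ x = x) : projB B = Q := by
  have e1 : Q * projB B = projB B := by
    refine Matrix.ext_of_mulVec_single fun k => ?_
    rw [← Matrix.mulVec_mulVec]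
    apply h2
    rw [Matrix.mulVec_mulVec, mul_projB B h, Matrix.zero_mulVec]
  have e2 : Q * projB B = Q := by
    rw [projB, Matrix.mul_sub, ← Matrix.mul_assoc, ← Matrix.mul_assoc, h1]
    simp
  rw [← e1, e2]

lemma projB_trace_ge : (n : ℝ) - Fintype.card ι ≤ (projB B).trace := by
  by_cases h : IsUnit (B * Bᵀ).det
  · rw [projB, Matrix.trace_sub, Matrix.mul_assoc, Matrix.trace_mul_comm, Matrix.mul_assoc,
      Matrix.nonsing_inv_mul _ h]
    simp
  · rw [projB_of_not B h]; simp

lemma projB_diag (k : Fin n) : ∑ l, projB B k l ^ 2 = projB B k k := by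
  conv_rhs => rw [← projB_idem B]
  rw [Matrix.mul_apply]
  refine Finset.sum_congr rfl fun l _ => ?_
  have : projB B l k = projB B k l := by
    conv_lhs => rw [← projB_transpose B]
    rfl
  rw [this, sq]

lemma projB_diag_nonneg (k : Fin n) : 0 ≤ projB B k k := by
  rw [← projB_diag]; positivity

lemma projB_diag_le (k : Fin n) : projB B k k ≤ 1 := by
  have h := projB_diag B k
  have h2 : projB B k k ^ 2 ≤ ∑ l, projB B k l ^ 2 :=
    Finset.single_le_sum (f := fun l => projB B k l ^ 2) (fun l _ => sq_nonneg _)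
      (Finset.mem_univ k)
  nlinarith

lemma gram_unit_iff : IsUnit (B * Bᵀ).det ↔ ∀ c : ι → ℝ, c ᵥ* B = 0 → c = 0 := by
  rw [isUnit_iff_ne_zero]
  constructor
  · intro h c hc
    by_contra hc0
    apply h
    rw [← Matrix.exists_vecMul_eq_zero_iff]
    exact ⟨c, hc0, by rw [← Matrix.vecMul_vecMul, hc, Matrix.zero_vecMul]⟩
  · intro h h0
    rw [← Matrix.exists_vecMul_eq_zero_iff] at h0
    obtain ⟨c, hc0, hc⟩ := h0
    apply hc0
    apply h
    have : (c ᵥ* B) ⬝ᵥ (c ᵥ* B) = 0 := by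
      have e : (c ᵥ* B) ⬝ᵥ (c ᵥ* B) = (c ᵥ* (B * Bᵀ)) ⬝ᵥ c := by
        rw [← Matrix.vecMul_vecMul, Matrix.vecMul_transpose, dotProduct_comm (B *ᵥ _),
          Matrix.dotProduct_mulVec]
      rw [e, hc, zero_dotProduct]
    exact dotProduct_self_eq_zero.1 this

lemma gram_unit_submatrix {κ : Type*} [Fintype κ] [DecidableEq κ] (e : κ → ι)
    (he : Function.Injective e) (h : IsUnit (B * Bᵀ).det) :
    IsUnit ((B.submatrix e id) * (B.submatrix e id)ᵀ).det := by
  rw [gram_unit_iff] at h ⊢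
  intro c hc
  have key := h (fun k => ∑ a, if e a = k then c a else 0) (by
    rw [← hc]
    ext l
    simp only [Matrix.vecMul, dotProduct, Matrix.submatrix_apply, id, Finset.sum_mul]
    rw [Finset.sum_comm]
    refine Finset.sum_congr rfl fun a _ => ?_
    simp)
  ext a
  have := congrFun key (e a)
  simpa [he.eq_iff] using this

/-- delete row `j` -/
def delRow (j : ι) : Matrix {k : ι // k ≠ j} (Fin n) ℝ := B.submatrix Subtype.val id

lemma delRow_s_ne (j : ι) (h : IsUnit (B * Bᵀ).det) :
    projB (delRow B j) *ᵥ (B j) ≠ 0 := by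
  intro h0
  rw [gram_unit_iff] at h
  rw [projB, Matrix.sub_mulVec, Matrix.one_mulVec, sub_eq_zero, Matrix.mul_assoc,
    ← Matrix.mulVec_mulVec, Matrix.mulVec_transpose] at h0
  set y := ((delRow B j * (delRow B j)ᵀ)⁻¹ * delRow B j) *ᵥ B j with hy
  have := congrFun (h (fun k => if hk : k ≠ j then - y ⟨k, hk⟩ else 1) (by
    ext l
    have h0l := congrFun h0 l
    simp only [Matrix.vecMul, dotProduct, Pi.zero_apply, delRow, Matrix.submatrix_apply, id]
      at h0l ⊢
    rw [Fintype.sum_eq_add_sum_subtype_ne _ j]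
    simp only [ne_eq, not_true_eq_false, dite_false, one_mul]
    rw [h0l, ← Finset.sum_add_distrib]
    refine Finset.sum_eq_zero fun k _ => ?_
    have := k.2
    simp [this])) j
  simp at this

lemma projB_downdate (j : ι) (h : IsUnit (B * Bᵀ).det) :
    projB B = projB (delRow B j) -
      ((projB (delRow B j) *ᵥ B j) ⬝ᵥ (projB (delRow B j) *ᵥ B j))⁻¹ •
        vecMulVec (projB (delRow B j) *ᵥ B j) (projB (delRow B j) *ᵥ B j) := by
  have hu : IsUnit ((delRow B j) * (delRow B j)ᵀ).det :=
    gram_unit_submatrix B _ Subtype.val_injective h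
  have hne := delRow_s_ne B j h
  set P := projB (delRow B j) with hP
  set v := P *ᵥ B j with hv
  have hs : v ⬝ᵥ v ≠ 0 := fun h0 => hne (dotProduct_self_eq_zero.1 h0)
  have hvdot : ∀ x, v ⬝ᵥ x = B j ⬝ᵥ (P *ᵥ x) := by
    intro x
    rw [hv, Matrix.dotProduct_mulVec, ← Matrix.mulVec_transpose, hP, projB_transpose]
  have hQ : ∀ x, (P - (v ⬝ᵥ v)⁻¹ • vecMulVec v v) *ᵥ x
      = P *ᵥ x - ((v ⬝ᵥ v)⁻¹ * (v ⬝ᵥ x)) • v := by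
    intro x
    rw [Matrix.sub_mulVec, Matrix.smul_mulVec, Matrix.vecMulVec_mulVec]
    ext l; simp; ring
  have hPP : ∀ x, P *ᵥ (P *ᵥ x) = P *ᵥ x := fun x => by
    rw [Matrix.mulVec_mulVec, hP, projB_idem]
  refine projB_unique B h _ ?_ ?_
  · have hk : ∀ k, (P - (v ⬝ᵥ v)⁻¹ • vecMulVec v v) *ᵥ (B k) = 0 := by
      intro k
      rw [hQ]
      by_cases hk : k = j
      · subst hk
        have : v ⬝ᵥ B k = v ⬝ᵥ v := by
          rw [hvdot v, dotProduct_comm v, hv, hPP, ]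
        rw [this, inv_mul_cancel₀ hs, one_smul, sub_self]
      · have : P *ᵥ B k = 0 := by
          have e := projB_mul_transpose _ hu
          ext l
          exact congrFun (congrFun e l) ⟨k, hk⟩
        rw [hvdot (B k), this]; simp
    ext l k
    have := congrFun (hk k) l
    simpa [Matrix.mul_apply, Matrix.mulVec, dotProduct] using this
  · intro x hx
    have h1 : P *ᵥ x = x := by
      apply projB_fix
      ext k
      exact congrFun hx k.1
    have h2 : v ⬝ᵥ x = 0 := by
      rw [hvdot, h1]
      exact congrFun hx j
    rw [hQ, h1, h2]; simp

end projB


section gauss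
open scoped RealInnerProductSpace

lemma gauss_on {n : ℕ} {κ : Type*} [Fintype κ] [DecidableEq κ]
    (e : κ → EuclideanSpace ℝ (Fin n)) (he : Orthonormal ℝ e) (a : κ) :
    ∫ g, ⟪e a, g⟫ ^ 2 / (∑ b, ⟪e b, g⟫ ^ 2) ∂(stdGaussian (EuclideanSpace ℝ (Fin n)))
      ≤ 1 / Fintype.card κ := by
  set γ := stdGaussian (EuclideanSpace ℝ (Fin n))
  have hmeas : ∀ b, Measurable (fun g : EuclideanSpace ℝ (Fin n) =>
      ⟪e b, g⟫ ^ 2 / (∑ b, ⟪e b, g⟫ ^ 2)) := by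
    intro b
    have h : ∀ b, Measurable (fun g : EuclideanSpace ℝ (Fin n) => ⟪e b, g⟫ ^ 2) := fun b => by
      fun_prop
    exact (h b).div (Finset.measurable_sum _ fun b _ => h b)
  have hb : ∀ b (g : EuclideanSpace ℝ (Fin n)), |⟪e b, g⟫ ^ 2 / (∑ b, ⟪e b, g⟫ ^ 2)| ≤ 1 := by
    intro b g
    rw [abs_of_nonneg (by positivity)]
    refine div_le_one_of_le₀ ?_ (by positivity)
    exact Finset.single_le_sum (f := fun b => ⟪e b, g⟫ ^ 2) (fun _ _ => sq_nonneg _)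
      (Finset.mem_univ b)
  have hintg : ∀ b, Integrable (fun g : EuclideanSpace ℝ (Fin n) =>
      ⟪e b, g⟫ ^ 2 / (∑ b, ⟪e b, g⟫ ^ 2)) γ := fun b =>
    Integrable.of_bound (hmeas b).aestronglyMeasurable 1 (Eventually.of_forall (hb b))
  have heq : ∀ b, ∫ g, ⟪e b, g⟫ ^ 2 / (∑ b, ⟪e b, g⟫ ^ 2) ∂γ
      = ∫ g, ⟪e a, g⟫ ^ 2 / (∑ b, ⟪e b, g⟫ ^ 2) ∂γ := by
    intro b
    set σ := (Submodule.reflection (ℝ ∙ (e a - e b))ᗮ) with hσ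
    have hσe : ∀ c, σ (e c) = e (Equiv.swap a b c) := by
      intro c
      by_cases hca : c = a
      · subst hca
        rw [Equiv.swap_apply_left]
        exact Submodule.reflection_sub (by rw [he.1, he.1])
      by_cases hcb : c = b
      · subst hcb
        rw [Equiv.swap_apply_right]
        have : σ (e a) = e c := Submodule.reflection_sub (by rw [he.1, he.1])
        rw [← this, hσ, Submodule.reflection_reflection]
      · rw [Equiv.swap_apply_of_ne_of_ne hca hcb]
        apply Submodule.reflection_mem_subspace_eq_self
        rw [Submodule.mem_orthogonal_singleton_iff_inner_right, inner_sub_left,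
          he.2 (Ne.symm hca), he.2 (Ne.symm hcb), sub_zero]
    have hin : ∀ c g, ⟪e c, σ g⟫ = ⟪e (Equiv.swap a b c), g⟫ := by
      intro c g
      rw [← hσe, ← LinearIsometryEquiv.inner_map_map σ (σ (e c)) g, hσ,
        Submodule.reflection_reflection]
    have hmap : γ.map σ = γ := stdGaussian_map σ
    conv_lhs => rw [← hmap]
    rw [integral_map σ.continuous.measurable.aemeasurable (hmeas b).aestronglyMeasurable]
    congr 1
    ext g
    simp only [hin, Equiv.swap_apply_right]
    congr 1
    exact Equiv.sum_comp (Equiv.swap a b) (fun c => ⟪e c, g⟫ ^ 2)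
  have hsum : ∑ b, ∫ g, ⟪e b, g⟫ ^ 2 / (∑ b, ⟪e b, g⟫ ^ 2) ∂γ ≤ 1 := by
    rw [← integral_finsetSum _ fun b _ => hintg b]
    have h1 : ∀ g : EuclideanSpace ℝ (Fin n), ∑ b, ⟪e b, g⟫ ^ 2 / (∑ b, ⟪e b, g⟫ ^ 2) ≤ 1 := by
      intro g
      rw [← Finset.sum_div]
      exact div_self_le_one _
    calc _ ≤ ∫ g, (1 : ℝ) ∂γ :=
          integral_mono (integrable_finsetSum _ fun b _ => hintg b) (integrable_const _) h1
      _ = 1 := by simp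
  simp only [heq] at hsum
  rw [Finset.sum_const, Finset.card_univ, nsmul_eq_mul] at hsum
  have : 0 < (Fintype.card κ : ℝ) := by exact_mod_cast Fintype.card_pos_iff.2 ⟨a⟩
  rw [le_div_iff₀ this]; linarith

/-- orthonormal frames, dot product form -/
lemma gauss_pi {n : ℕ} {κ : Type*} [Fintype κ] [DecidableEq κ]
    (e : κ → Fin n → ℝ) (he : ∀ a b, e a ⬝ᵥ e b = if a = b then 1 else 0) (a : κ) :
    ∫ g, (e a ⬝ᵥ g) ^ 2 / (∑ b, (e b ⬝ᵥ g) ^ 2) ∂(gaussianPi n) ≤ 1 / Fintype.card κ := by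
  have h := gauss_on (fun k => WithLp.toLp 2 (e k)) (by
    rw [orthonormal_iff_ite]
    intro i j
    rw [EuclideanSpace.inner_eq_star_dotProduct, dotProduct_comm]
    simpa using he i j) a
  rw [← map_pi_eq_stdGaussian, integral_map] at h
  · refine le_trans (le_of_eq ?_) h
    rw [gaussianPi]
    congr 1
    ext g
    simp only [EuclideanSpace.inner_eq_star_dotProduct]
    simp only [star_trivial, dotProduct_comm g]
  · fun_prop
  · apply Measurable.aestronglyMeasurable
    have h : ∀ b, Measurable (fun g : EuclideanSpace ℝ (Fin n) =>
      ⟪WithLp.toLp 2 (e b), g⟫ ^ 2) := fun b => by fun_prop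
    exact (h a).div (Finset.measurable_sum _ fun b _ => h b)

lemma exists_frame {n : ℕ} (R : Submodule ℝ (Fin n → ℝ)) (w : Fin n → ℝ) (hw : w ∈ R)
    (hw1 : w ⬝ᵥ w = 1) :
    ∃ (κ : Type) (_ : Fintype κ) (_ : DecidableEq κ) (e : κ → Fin n → ℝ) (a : κ),
      (∀ a b, e a ⬝ᵥ e b = if a = b then 1 else 0) ∧ e a = w ∧ (∀ b, e b ∈ R) ∧
      Fintype.card κ = Module.finrank ℝ R := by
  classical
  let L := (WithLp.linearEquiv 2 ℝ (Fin n → ℝ))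
  let R' : Submodule ℝ (EuclideanSpace ℝ (Fin n)) := R.comap L.toLinearMap
  have hw' : WithLp.toLp 2 w ∈ R' := hw
  have hdim : Module.finrank ℝ R' = Module.finrank ℝ R := by
    have := LinearEquiv.finrank_map_eq L.symm R
    rw [← this]
    have e : R' = R.map (L.symm : (Fin n → ℝ) →ₗ[ℝ] WithLp 2 (Fin n → ℝ)) :=
      Submodule.comap_equiv_eq_map_symm L R
    rw [e]
  let v : Set R' := {⟨WithLp.toLp 2 w, hw'⟩}
  have hv : Orthonormal ℝ ((↑) : v → R') := by
    constructor
    · rintro ⟨x, rfl⟩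
      have : ‖WithLp.toLp 2 w‖ ^ 2 = 1 := by
        rw [← real_inner_self_eq_norm_sq, EuclideanSpace.inner_eq_star_dotProduct]
        simpa using hw1
      have h2 := (pow_eq_one_iff_of_nonneg (norm_nonneg (WithLp.toLp 2 w)) two_ne_zero).1 this
      exact h2
    · rintro ⟨x, rfl⟩ ⟨y, rfl⟩ hxy
      exact absurd rfl hxy
  obtain ⟨u, b, hu, hb⟩ := hv.exists_orthonormalBasis_extension
  have hmem : (⟨WithLp.toLp 2 w, hw'⟩ : R') ∈ u := hu rfl
  refine ⟨Fin (Fintype.card u), inferInstance, inferInstance,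
    fun k => WithLp.ofLp ((b ((Fintype.equivFin u).symm k) : R') : EuclideanSpace ℝ (Fin n)),
    Fintype.equivFin u ⟨_, hmem⟩, ?_, ?_, ?_, ?_⟩
  · intro c d
    have := (orthonormal_iff_ite.1 b.orthonormal) ((Fintype.equivFin u).symm c)
      ((Fintype.equivFin u).symm d)
    rw [Submodule.coe_inner, EuclideanSpace.inner_eq_star_dotProduct, dotProduct_comm] at this
    simpa using this
  · simp [hb]
  · intro k
    exact (b ((Fintype.equivFin u).symm k)).2
  · rw [Fintype.card_fin, ← hdim, Module.finrank_eq_card_basis b.toBasis]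

instance (n : ℕ) : IsProbabilityMeasure (gaussianPi n) := by
  unfold gaussianPi; infer_instance

lemma euclid_meas (n : ℕ) : Measurable (fun x : Fin n → ℝ => (euclidNorm x)⁻¹ • x) := by
  unfold euclidNorm
  fun_prop

instance (n : ℕ) : IsProbabilityMeasure (uniformSphere n) := by
  unfold uniformSphere
  exact Measure.isProbabilityMeasure_map (euclid_meas n).aemeasurable

instance (n p : ℕ) : IsProbabilityMeasure (sphereLaw n p) := by
  unfold sphereLaw; infer_instance

lemma gauss_bound {n : ℕ} {ι : Type*} [Fintype ι] [DecidableEq ι] (a : Fin n → ℝ) (C : ℝ)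
    (hC : 1 ≤ C) (ha : ∀ k, C⁻¹ ≤ a k ^ 2 ∧ a k ^ 2 ≤ C) (B : Matrix ι (Fin n) ℝ)
    (hu : IsUnit (B * Bᵀ).det) (hcard : Fintype.card ι < n) (l : Fin n) :
    ∫ x, ((projB B *ᵥ (diagonal a *ᵥ x)) l) ^ 2 /
      ((projB B *ᵥ (diagonal a *ᵥ x)) ⬝ᵥ (projB B *ᵥ (diagonal a *ᵥ x))) ∂(gaussianPi n)
      ≤ C ^ 2 / (n - Fintype.card ι) := by
  have hC0 : 0 < C := by linarith
  have hm : 0 < (n : ℝ) - Fintype.card ι := by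
    have : (Fintype.card ι : ℝ) < n := by exact_mod_cast hcard
    linarith
  have ha0 : ∀ k, a k ≠ 0 := by
    intro k hk
    have := (ha k).1
    have h2 : 0 < C⁻¹ := by positivity
    rw [hk] at this; norm_num at this; linarith
  set P := projB B with hP
  set w : Fin n → ℝ := fun k => a k * P l k with hw
  have hv : ∀ x, (P *ᵥ (diagonal a *ᵥ x)) l = w ⬝ᵥ x := by
    intro x
    simp only [Matrix.mulVec, dotProduct, hw, Matrix.diagonal_apply, ite_mul, zero_mul,
      Finset.sum_ite_eq, Finset.mem_univ, if_true]
    exact Finset.sum_congr rfl fun k _ => by ring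
  have hww : w ⬝ᵥ w ≤ C := by
    calc w ⬝ᵥ w = ∑ k, a k ^ 2 * P l k ^ 2 := by
          simp only [dotProduct, hw]; exact Finset.sum_congr rfl fun k _ => by ring
      _ ≤ ∑ k, C * P l k ^ 2 := Finset.sum_le_sum fun k _ =>
          mul_le_mul_of_nonneg_right (ha k).2 (sq_nonneg _)
      _ = C * P l l := by rw [← Finset.mul_sum, hP, projB_diag]
      _ ≤ C * 1 := by gcongr; exact projB_diag_le B l
      _ = C := mul_one C
  by_cases hw0 : w ⬝ᵥ w = 0
  · have : w = 0 := dotProduct_self_eq_zero.1 hw0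
    simp only [hv, this, zero_dotProduct]
    norm_num
    positivity
  have hwpos : 0 < w ⬝ᵥ w := lt_of_le_of_ne (by
    simp only [dotProduct]; exact Finset.sum_nonneg fun k _ => mul_self_nonneg _) (Ne.symm hw0)
  let R : Submodule ℝ (Fin n → ℝ) :=
    (LinearMap.ker B.mulVecLin).map (diagonal a).mulVecLin
  have hinj : Function.Injective (diagonal a).mulVecLin := by
    intro x y hxy
    ext k
    have := congrFun hxy k
    simp only [Matrix.mulVecLin_apply, Matrix.mulVec_diagonal] at this
    exact mul_left_cancel₀ (ha0 k) this
  have hdim : (n : ℝ) - Fintype.card ι ≤ Module.finrank ℝ R := by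
    have h1 : Module.finrank ℝ R = Module.finrank ℝ (LinearMap.ker B.mulVecLin) :=
      (Submodule.equivMapOfInjective _ hinj _).finrank_eq.symm
    have h2 := LinearMap.finrank_range_add_finrank_ker B.mulVecLin
    have h3 : Module.finrank ℝ (LinearMap.range B.mulVecLin) ≤ Fintype.card ι := by
      have := Submodule.finrank_le (LinearMap.range B.mulVecLin)
      simpa using this
    rw [Module.finrank_fin_fun] at h2
    rw [h1, sub_le_iff_le_add]
    norm_cast
    omega
  have hwR : w ∈ R := by
    refine ⟨P l, ?_, ?_⟩
    · rw [SetLike.mem_coe, LinearMap.mem_ker, Matrix.mulVecLin_apply]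
      have h := mul_projB B hu
      ext k
      have h2 := congrFun (congrFun h k) l
      rw [← projB_transpose] at h2
      exact h2
    · ext k
      simp [Matrix.mulVec_diagonal, hw]
  set t := Real.sqrt (w ⬝ᵥ w) with ht
  have htt : t * t = w ⬝ᵥ w := Real.mul_self_sqrt hwpos.le
  have htpos : 0 < t := Real.sqrt_pos.2 hwpos
  obtain ⟨κ, _, _, e, a0, he, hea, heR, hcardκ⟩ := exists_frame R (t⁻¹ • w) (R.smul_mem _ hwR) (by
    rw [smul_dotProduct, dotProduct_smul, ← htt]
    simp only [smul_eq_mul]; field_simp)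
  have hg := gauss_pi e he a0
  -- pointwise comparison
  have hS : ∀ g : Fin n → ℝ, ∑ b, (e b ⬝ᵥ g) ^ 2 ≤
      C * ((P *ᵥ (diagonal a *ᵥ g)) ⬝ᵥ (P *ᵥ (diagonal a *ᵥ g))) := by
    intro g
    set S := ∑ b, (e b ⬝ᵥ g) ^ 2 with hSdef
    have hS0 : 0 ≤ S := by positivity
    set z := P *ᵥ (diagonal a *ᵥ g) with hz
    set r := ∑ b, (e b ⬝ᵥ g) • e b with hr
    have hrR : r ∈ R := R.sum_mem fun b _ => R.smul_mem _ (heR b)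
    have hrg : r ⬝ᵥ g = S := by
      rw [hr, sum_dotProduct]
      exact Finset.sum_congr rfl fun b _ => by rw [smul_dotProduct, smul_eq_mul, sq]
    have hrr : r ⬝ᵥ r = S := by
      conv_lhs => rw [hr]
      rw [sum_dotProduct]
      refine Finset.sum_congr rfl fun b _ => ?_
      rw [smul_dotProduct, dotProduct_sum, smul_eq_mul, sq]
      congr 1
      simp [he]
    obtain ⟨v, hvV, hvr⟩ := hrR
    rw [SetLike.mem_coe, LinearMap.mem_ker, Matrix.mulVecLin_apply] at hvV
    rw [Matrix.mulVecLin_apply] at hvr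
    have hvP : P *ᵥ v = v := projB_fix B v hvV
    have h1 : S = v ⬝ᵥ z := by
      rw [← hrg, ← hvr, hz, Matrix.dotProduct_mulVec v P, ← Matrix.mulVec_transpose, hP,
        projB_transpose, ← hP, hvP]
      simp only [dotProduct, Matrix.mulVec_diagonal]
      exact Finset.sum_congr rfl fun k _ => by ring
    have h2 : v ⬝ᵥ v ≤ C * S := by
      rw [← hrr, ← hvr]
      simp only [dotProduct, Matrix.mulVec_diagonal, Finset.mul_sum]
      refine Finset.sum_le_sum fun k _ => ?_
      have h3 : 1 ≤ C * a k ^ 2 := by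
        have := mul_le_mul_of_nonneg_left (ha k).1 hC0.le
        rwa [mul_inv_cancel₀ hC0.ne'] at this
      nlinarith [mul_le_mul_of_nonneg_right h3 (mul_self_nonneg (v k))]
    have h3 : (v ⬝ᵥ z) ^ 2 ≤ (v ⬝ᵥ v) * (z ⬝ᵥ z) := by
      have := Finset.sum_mul_sq_le_sq_mul_sq Finset.univ v z
      simpa only [dotProduct, sq] using this
    have hzz : 0 ≤ z ⬝ᵥ z := by
      simp only [dotProduct]; exact Finset.sum_nonneg fun k _ => mul_self_nonneg _
    rw [← h1] at h3
    rcases hS0.eq_or_lt with h0 | h0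
    · rw [← h0]; positivity
    · have : S * S ≤ S * (C * (z ⬝ᵥ z)) := by nlinarith
      exact le_of_mul_le_mul_left this h0
  have hpt : ∀ g : Fin n → ℝ, ((P *ᵥ (diagonal a *ᵥ g)) l) ^ 2 /
      ((P *ᵥ (diagonal a *ᵥ g)) ⬝ᵥ (P *ᵥ (diagonal a *ᵥ g)))
      ≤ C ^ 2 * ((e a0 ⬝ᵥ g) ^ 2 / ∑ b, (e b ⬝ᵥ g) ^ 2) := by
    intro g
    have h1 : ((P *ᵥ (diagonal a *ᵥ g)) l) ^ 2 = (w ⬝ᵥ w) * (e a0 ⬝ᵥ g) ^ 2 := by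
      rw [hv, hea, smul_dotProduct, smul_eq_mul, ← htt]; field_simp
    have hSg := hS g
    set z := P *ᵥ (diagonal a *ᵥ g) with hz
    set S := ∑ b, (e b ⬝ᵥ g) ^ 2 with hSdef
    have hS0 : 0 ≤ S := by positivity
    have hle : (e a0 ⬝ᵥ g) ^ 2 ≤ S :=
      Finset.single_le_sum (f := fun b => (e b ⬝ᵥ g) ^ 2) (fun _ _ => sq_nonneg _)
        (Finset.mem_univ a0)
    rw [h1]
    rcases hS0.eq_or_lt with h0 | h0
    · have : (e a0 ⬝ᵥ g) ^ 2 = 0 := le_antisymm (by rw [h0]; exact hle) (sq_nonneg _)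
      rw [this]; simp
    · have hz0 : 0 < z ⬝ᵥ z := by
        by_contra hcon
        nlinarith [not_lt.1 hcon]
      rw [← mul_div_assoc, div_le_div_iff₀ hz0 h0]
      have := sq_nonneg (e a0 ⬝ᵥ g)
      calc (w ⬝ᵥ w) * (e a0 ⬝ᵥ g) ^ 2 * S ≤ C * (e a0 ⬝ᵥ g) ^ 2 * (C * (z ⬝ᵥ z)) := by gcongr
        _ = _ := by ring
  have hcκ : (n : ℝ) - Fintype.card ι ≤ Fintype.card κ := by rw [hcardκ]; exact hdim
  have mdot : ∀ u : Fin n → ℝ, Measurable (fun g : Fin n → ℝ => u ⬝ᵥ g) := fun u => by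
    unfold dotProduct; fun_prop
  have mR : Measurable (fun g : Fin n → ℝ => (e a0 ⬝ᵥ g) ^ 2 / ∑ b, (e b ⬝ᵥ g) ^ 2) :=
    ((mdot _).pow_const 2).div (Finset.measurable_sum _ fun b _ => (mdot _).pow_const 2)
  have iR : Integrable (fun g : Fin n → ℝ => (e a0 ⬝ᵥ g) ^ 2 / ∑ b, (e b ⬝ᵥ g) ^ 2)
      (gaussianPi n) := by
    refine bdd_integrable _ mR (M := 1) fun g => ?_
    rw [abs_of_nonneg (by positivity)]
    refine div_le_one_of_le₀ ?_ (by positivity)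
    exact Finset.single_le_sum (f := fun b => (e b ⬝ᵥ g) ^ 2) (fun _ _ => sq_nonneg _)
      (Finset.mem_univ a0)
  calc _ ≤ ∫ g, C ^ 2 * ((e a0 ⬝ᵥ g) ^ 2 / ∑ b, (e b ⬝ᵥ g) ^ 2) ∂(gaussianPi n) := by
        refine integral_mono_of_nonneg (Eventually.of_forall fun g => ?_) (iR.const_mul _)
          (Eventually.of_forall hpt)
        refine div_nonneg (sq_nonneg _) ?_
        simp only [dotProduct]; exact Finset.sum_nonneg fun k _ => mul_self_nonneg _
    _ = C ^ 2 * ∫ g, ((e a0 ⬝ᵥ g) ^ 2 / ∑ b, (e b ⬝ᵥ g) ^ 2) ∂(gaussianPi n) :=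
        integral_const_mul _ _
    _ ≤ C ^ 2 * (1 / Fintype.card κ) := by gcongr
    _ ≤ C ^ 2 * (1 / (n - Fintype.card ι)) := by gcongr
    _ = _ := by ring

end gauss


section meas
variable {Ω : Type*} [MeasurableSpace Ω]

lemma meas_det {ι : Type*} [Fintype ι] [DecidableEq ι] (M : Ω → Matrix ι ι ℝ)
    (h : ∀ i j, Measurable fun ω => M ω i j) : Measurable fun ω => (M ω).det := by
  simp only [Matrix.det_apply]
  refine Finset.measurable_sum _ fun σ _ => ?_
  exact (Finset.measurable_prod _ fun i _ => h _ _).const_smul _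

lemma meas_inv {ι : Type*} [Fintype ι] [DecidableEq ι] (M : Ω → Matrix ι ι ℝ)
    (h : ∀ i j, Measurable fun ω => M ω i j) (i j : ι) : Measurable fun ω => (M ω)⁻¹ i j := by
  simp only [Matrix.inv_def, Matrix.smul_apply, Ring.inverse_eq_inv', smul_eq_mul,
    Matrix.adjugate_apply]
  refine (meas_det M h).inv.mul (meas_det _ fun k l => ?_)
  by_cases hk : k = j
  · subst hk; simp
  · simp only [Matrix.updateRow_ne hk]; exact h _ _

lemma meas_mul {ι κ τ : Type*} [Fintype κ] (M : Ω → Matrix ι κ ℝ) (N : Ω → Matrix κ τ ℝ)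
    (h : ∀ i j, Measurable fun ω => M ω i j) (h' : ∀ i j, Measurable fun ω => N ω i j)
    (i : ι) (j : τ) : Measurable fun ω => (M ω * N ω) i j := by
  simp only [Matrix.mul_apply]
  exact Finset.measurable_sum _ fun k _ => (h _ _).mul (h' _ _)

lemma meas_projB {ι : Type*} [Fintype ι] [DecidableEq ι] {n : ℕ} (B : Ω → Matrix ι (Fin n) ℝ)
    (h : ∀ i j, Measurable fun ω => B ω i j) (k l : Fin n) :
    Measurable fun ω => projB (B ω) k l := by
  simp only [projB, Matrix.sub_apply]
  refine measurable_const.sub ?_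
  refine meas_mul _ _ (meas_mul _ _ (fun i j => ?_) (meas_inv _ (meas_mul _ _ h fun i j => ?_))) h _ _
  · exact h j i
  · exact h j i

end meas

lemma meas_rowMat {n p : ℕ} (A : Matrix (Fin n) (Fin n) ℝ) (i : ℕ) (k : Fin i) (l : Fin n) :
    Measurable fun ω : Fin p → Fin n → ℝ => rowMat A ω i k l := by
  simp only [rowMat, Matrix.of_apply, Matrix.mulVec, dotProduct]
  refine Finset.measurable_sum _ fun m _ => measurable_const.mul ?_
  unfold uVec
  split_ifs
  · fun_prop
  · exact measurable_const

lemma gaussian_hyperplane {n : ℕ} (w : Fin n → ℝ) (hw : w ≠ 0) :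
    ∀ᵐ x ∂(gaussianPi n), w ⬝ᵥ x ≠ 0 := by
  obtain ⟨k, hk⟩ := Function.ne_iff.1 hw
  unfold gaussianPi
  have hm : Measurable (fun x : Fin n → ℝ => w ⬝ᵥ x) := by unfold dotProduct; fun_prop
  refine pi_ae_of_update _ k _ (hm (measurableSet_singleton 0)).compl ?_
  refine Eventually.of_forall fun g => ?_
  have : NullSingletonClass (gaussianReal 0 1) := nullSingletonClass_gaussianReal one_ne_zero
  have hsub : {x : ℝ | ¬ (w ⬝ᵥ Function.update g k x ≠ 0)}.Subsingleton := by
    intro x hx y hy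
    simp only [ne_eq, not_not, Set.mem_ofPred_eq] at hx hy
    have e : w ⬝ᵥ Function.update g k x - w ⬝ᵥ Function.update g k y = w k * (x - y) := by
      rw [← dotProduct_sub, ← Function.update_sub]
      simp [dotProduct, Function.update_apply]
    rw [hx, hy, sub_zero] at e
    have := (mul_eq_zero.1 e.symm).resolve_left hk
    linarith
  exact hsub.measure_zero _

lemma sphere_hyperplane {n : ℕ} (w : Fin n → ℝ) (hw : w ≠ 0) :
    ∀ᵐ x ∂(uniformSphere n), w ⬝ᵥ x ≠ 0 := by
  unfold uniformSphere
  have hm : Measurable (fun x : Fin n → ℝ => w ⬝ᵥ x) := by unfold dotProduct; fun_prop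
  have hs : MeasurableSet {x : Fin n → ℝ | w ⬝ᵥ x ≠ 0} := (hm (measurableSet_singleton 0)).compl
  rw [ae_map_iff (euclid_meas n).aemeasurable hs]
  filter_upwards [gaussian_hyperplane w hw] with x hx
  rw [dotProduct_smul, smul_eq_mul]
  refine mul_ne_zero (inv_ne_zero ?_) hx
  intro h0
  apply hx
  have h1 : ∑ j, x j ^ 2 = 0 := by
    have := (Real.sqrt_eq_zero (by positivity)).1 h0
    exact this
  have : x = 0 := by
    ext j
    have := (Finset.sum_eq_zero_iff_of_nonneg fun j _ => sq_nonneg (x j)).1 h1 j (Finset.mem_univ j)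
    simpa using this
  rw [this, dotProduct_zero]

lemma sphere_ratio {n : ℕ} (M : Matrix (Fin n) (Fin n) ℝ) (l : Fin n) :
    ∫ x, ((M *ᵥ x) l) ^ 2 / ((M *ᵥ x) ⬝ᵥ (M *ᵥ x)) ∂(uniformSphere n)
     = ∫ x, ((M *ᵥ x) l) ^ 2 / ((M *ᵥ x) ⬝ᵥ (M *ᵥ x)) ∂(gaussianPi n) := by
  unfold uniformSphere
  rw [integral_map (euclid_meas n).aemeasurable]
  · congr 1
    ext x
    rw [Matrix.mulVec_smul, smul_dotProduct, dotProduct_smul, Pi.smul_apply]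
    simp only [smul_eq_mul]
    by_cases h0 : euclidNorm x = 0
    · have h1 : ∑ j, x j ^ 2 = 0 := (Real.sqrt_eq_zero (by positivity)).1 h0
      have : x = 0 := by
        ext j
        have := (Finset.sum_eq_zero_iff_of_nonneg fun j _ => sq_nonneg (x j)).1 h1 j
          (Finset.mem_univ j)
        simpa using this
      rw [this]; simp
    · rw [mul_pow, ← mul_assoc, ← sq, mul_div_mul_left]
      exact pow_ne_zero 2 (inv_ne_zero h0)
  · apply Measurable.aestronglyMeasurable
    unfold mulVec dotProduct
    fun_prop

lemma rowMat_update {n p : ℕ} (A : Matrix (Fin n) (Fin n) ℝ) (ω : Fin p → Fin n → ℝ) (i : ℕ)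
    (j : Fin p) (x : Fin n → ℝ) (k : Fin i) (hk : (k : ℕ) ≠ j) :
    rowMat A (Function.update ω j x) i k = rowMat A ω i k := by
  ext l
  simp only [rowMat, Matrix.of_apply, uVec]
  split_ifs with h
  · rw [Function.update_of_ne]
    intro h2; apply hk; rw [← h2]
  · rfl

lemma rowMat_update_self {n p : ℕ} (A : Matrix (Fin n) (Fin n) ℝ) (ω : Fin p → Fin n → ℝ) (i : ℕ)
    (j : Fin p) (x : Fin n → ℝ) (k : Fin i) (hk : (k : ℕ) = j) :
    rowMat A (Function.update ω j x) i k = A *ᵥ x := by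
  ext l
  have h : (k : ℕ) < p := by rw [hk]; exact j.2
  have : (⟨(k : ℕ), h⟩ : Fin p) = j := Fin.ext hk
  simp only [rowMat, Matrix.of_apply, uVec, dif_pos h, this, Function.update_self]

lemma good_ae {n p : ℕ} (hp : p ≤ n) (a : Fin n → ℝ) (ha : ∀ k, a k ≠ 0) (i : ℕ) (hi : i ≤ p) :
    ∀ᵐ ω ∂(sphereLaw n p), IsUnit (rowMat (diagonal a) ω i * (rowMat (diagonal a) ω i)ᵀ).det := by
  induction i with
  | zero => exact Eventually.of_forall fun ω => by simp
  | succ i ih =>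
    have ih := ih (by omega)
    set A := diagonal a with hA
    let j : Fin p := ⟨i, hi⟩
    have hstep : ∀ᵐ ω ∂(sphereLaw n p),
        (projB (rowMat A ω i) *ᵥ (A *ᵥ ω j)) ⬝ᵥ (projB (rowMat A ω i) *ᵥ (A *ᵥ ω j)) ≠ 0 := by
      unfold sphereLaw
      refine pi_ae_of_update _ j _ ?_ ?_
      · have hm : Measurable (fun ω : Fin p → Fin n → ℝ =>
            (projB (rowMat A ω i) *ᵥ (A *ᵥ ω j)) ⬝ᵥ (projB (rowMat A ω i) *ᵥ (A *ᵥ ω j))) := by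
          have hv : ∀ l, Measurable fun ω : Fin p → Fin n → ℝ =>
              (projB (rowMat A ω i) *ᵥ (A *ᵥ ω j)) l := by
            intro l
            simp only [Matrix.mulVec, dotProduct]
            refine Finset.measurable_sum _ fun m _ => ?_
            refine (meas_projB _ (meas_rowMat A i) l m).mul ?_
            fun_prop
          simp only [dotProduct]
          exact Finset.measurable_sum _ fun m _ => (hv m).mul (hv m)
        exact (hm (measurableSet_singleton 0)).compl
      · refine Eventually.of_forall fun ω => ?_
        have hrow : ∀ x, rowMat A (Function.update ω j x) i = rowMat A ω i := by
          intro x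
          ext k l
          exact congrFun (rowMat_update A ω i j x k (by have := k.2; simp only [j]; omega)) l
        simp only [hrow, Function.update_self]
        set P := projB (rowMat A ω i) with hP
        have htr : 0 < P.trace := by
          have := projB_trace_ge (rowMat A ω i)
          rw [Fintype.card_fin] at this
          have h2 : (i : ℝ) < n := by exact_mod_cast (by omega : i < n)
          linarith
        have hP0 : P * A ≠ 0 := by
          intro h0
          have : P = 0 := by
            ext k l
            have := congrFun (congrFun h0 k) l
            rw [hA, Matrix.mul_diagonal] at this
            exact (mul_eq_zero.1 this).resolve_right (ha l)
          rw [this] at htr; simp at htr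
        obtain ⟨l, hl⟩ := Function.ne_iff.1 hP0
        filter_upwards [sphere_hyperplane ((P * A) l) hl] with x hx h0
        apply hx
        have := congrFun (dotProduct_self_eq_zero.1 h0) l
        rw [Matrix.mulVec_mulVec] at this
        exact this
    filter_upwards [ih, hstep] with ω h1 h2
    have hPB := projB_mul_transpose _ h1
    rw [gram_unit_iff] at h1 ⊢
    intro c hc
    have hu : uVec ω i = ω j := dif_pos (show i < p from hi)
    have hsplit : (fun k : Fin i => c k.castSucc) ᵥ* rowMat A ω i + c (Fin.last i) • (A *ᵥ ω j)
        = 0 := by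
      ext l
      have := congrFun hc l
      simp only [Matrix.vecMul, dotProduct, Fin.sum_univ_castSucc] at this
      rw [← this]
      simp only [Pi.add_apply, Matrix.vecMul, dotProduct, Pi.smul_apply, smul_eq_mul, rowMat,
        Matrix.of_apply, Fin.val_castSucc, Fin.val_last, hu]
    have hlast : c (Fin.last i) = 0 := by
      have h3 := congrArg (fun v => projB (rowMat A ω i) *ᵥ v) hsplit
      simp only [Matrix.mulVec_add, Matrix.mulVec_smul, Matrix.mulVec_zero] at h3
      rw [← Matrix.mulVec_transpose, Matrix.mulVec_mulVec, hPB, Matrix.zero_mulVec, zero_add] at h3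
      rcases smul_eq_zero.1 h3 with h4 | h4
      · exact h4
      · exact absurd (by rw [h4, dotProduct_zero]) h2
    rw [hlast, zero_smul, add_zero] at hsplit
    have hrest := h1 _ hsplit
    ext k
    refine Fin.lastCases hlast (fun k => ?_) k
    exact congrFun hrest k


def trA {n : ℕ} (a : Fin n → ℝ) (P : Matrix (Fin n) (Fin n) ℝ) : ℝ := ∑ k, a k ^ 2 * P k k

lemma trA_eq1 {n : ℕ} (a : Fin n → ℝ) (P : Matrix (Fin n) (Fin n) ℝ) :
    Matrix.trace (diagonal a * diagonal a * P) = trA a P := by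
  rw [Matrix.diagonal_mul_diagonal]
  simp only [Matrix.trace, Matrix.diag_apply, Matrix.diagonal_mul, trA, sq]

lemma trA_eq2 {n : ℕ} (a : Fin n → ℝ) (P : Matrix (Fin n) (Fin n) ℝ) :
    Matrix.trace (diagonal a * P * diagonal a) = trA a P := by
  rw [← trA_eq1, Matrix.trace_mul_comm, Matrix.mul_assoc]

lemma trA_bound {n : ℕ} {ι : Type*} [Fintype ι] [DecidableEq ι] (a : Fin n → ℝ)
    (B : Matrix ι (Fin n) ℝ) : |trA a (projB B)| ≤ ∑ k, a k ^ 2 := by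
  have h0 : 0 ≤ trA a (projB B) :=
    Finset.sum_nonneg fun k _ => mul_nonneg (sq_nonneg _) (projB_diag_nonneg B k)
  rw [abs_of_nonneg h0]
  refine Finset.sum_le_sum fun k _ => ?_
  have := projB_diag_le B k
  nlinarith [sq_nonneg (a k)]

lemma trA_meas {Ω : Type*} [MeasurableSpace Ω] {n : ℕ} {ι : Type*} [Fintype ι] [DecidableEq ι]
    (a : Fin n → ℝ) (B : Ω → Matrix ι (Fin n) ℝ) (h : ∀ i j, Measurable fun ω => B ω i j) :
    Measurable fun ω => trA a (projB (B ω)) := by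
  unfold trA
  exact Finset.measurable_sum _ fun k _ => measurable_const.mul (meas_projB B h k k)

lemma delRow_update {n p : ℕ} (A : Matrix (Fin n) (Fin n) ℝ) (ω : Fin p → Fin n → ℝ) (i : ℕ)
    (j : Fin p) (hj : (j : ℕ) < i) (x : Fin n → ℝ) :
    delRow (rowMat A (Function.update ω j x) i) ⟨j, hj⟩ = delRow (rowMat A ω i) ⟨j, hj⟩ := by
  ext k l
  exact congrFun (rowMat_update A ω i j x k.1 (fun h => k.2 (Fin.ext h))) l

lemma downdate_ineq {n : ℕ} {ι : Type*} [Fintype ι] [DecidableEq ι] (a : Fin n → ℝ)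
    (B : Matrix ι (Fin n) ℝ) (j : ι) (h : IsUnit (B * Bᵀ).det) :
    (trA a (projB B) - (trA a (projB (delRow B j)) - 1)) ^ 2 ≤
      ∑ l, (a l ^ 2 - 1) ^ 2 * (((projB (delRow B j) *ᵥ B j) l) ^ 2 /
        ((projB (delRow B j) *ᵥ B j) ⬝ᵥ (projB (delRow B j) *ᵥ B j))) := by
  have hne := delRow_s_ne B j h
  rw [projB_downdate B j h]
  set P := projB (delRow B j)
  set v := P *ᵥ B j
  have hs : v ⬝ᵥ v ≠ 0 := fun h0 => hne (dotProduct_self_eq_zero.1 h0)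
  have hs0 : 0 < v ⬝ᵥ v := lt_of_le_of_ne
    (by simp only [dotProduct]; exact Finset.sum_nonneg fun k _ => mul_self_nonneg _) (Ne.symm hs)
  set s := v ⬝ᵥ v with hsdef
  have e1 : trA a (P - s⁻¹ • vecMulVec v v) = trA a P - s⁻¹ * ∑ l, a l ^ 2 * v l ^ 2 := by
    simp only [trA, Matrix.sub_apply, Matrix.smul_apply, vecMulVec_apply, smul_eq_mul,
      Finset.mul_sum, ← Finset.sum_sub_distrib]
    exact Finset.sum_congr rfl fun k _ => by ring
  have hsv : s = ∑ l, v l ^ 2 := by simp only [hsdef, dotProduct, sq]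
  have e2 : trA a (P - s⁻¹ • vecMulVec v v) - (trA a P - 1)
      = - (s⁻¹ * ∑ l, ((a l ^ 2 - 1) * v l) * v l) := by
    rw [e1]
    have : ∑ l, ((a l ^ 2 - 1) * v l) * v l = ∑ l, a l ^ 2 * v l ^ 2 - s := by
      rw [hsv, ← Finset.sum_sub_distrib]
      exact Finset.sum_congr rfl fun k _ => by ring
    rw [this]; field_simp; ring
  have e3 : ∑ l, (a l ^ 2 - 1) ^ 2 * ((v l) ^ 2 / s) = s⁻¹ * ∑ l, ((a l ^ 2 - 1) * v l) ^ 2 := by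
    rw [Finset.mul_sum]
    exact Finset.sum_congr rfl fun k _ => by field_simp
  have cs := Finset.sum_mul_sq_le_sq_mul_sq Finset.univ (fun l => (a l ^ 2 - 1) * v l) v
  rw [← hsv] at cs
  rw [e2, e3, neg_sq, mul_pow]
  calc s⁻¹ ^ 2 * (∑ l, ((a l ^ 2 - 1) * v l) * v l) ^ 2
      ≤ s⁻¹ ^ 2 * ((∑ l, ((a l ^ 2 - 1) * v l) ^ 2) * s) := by gcongr
    _ = _ := by field_simp

lemma coord_bound {n p : ℕ} (hp : p ≤ n) (a : Fin n → ℝ) (C : ℝ) (hC : 1 ≤ C)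
    (ha : ∀ k, C⁻¹ ≤ a k ^ 2 ∧ a k ^ 2 ≤ C) (i : ℕ) (hi : i < p) (j : Fin p) (hj : (j : ℕ) < i) :
    ∫ ω, (trA a (projB (rowMat (diagonal a) ω i)) -
      (trA a (projB (delRow (rowMat (diagonal a) ω i) ⟨j, hj⟩)) - 1)) ^ 2 ∂(sphereLaw n p)
      ≤ C ^ 2 * (∑ k, (a k ^ 2 - 1) ^ 2) / (n - i) := by
  have hC0 : 0 < C := by linarith
  have ha0 : ∀ k, a k ≠ 0 := by
    intro k hk
    have := (ha k).1
    have h2 : 0 < C⁻¹ := by positivity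
    rw [hk] at this; norm_num at this; linarith
  have hni : (0 : ℝ) < n - i := by
    have : (i : ℝ) < n := by exact_mod_cast (by omega : i < n)
    linarith
  set A := diagonal a with hA
  have hgood := good_ae hp a ha0 i hi.le
  rw [← hA] at hgood
  unfold sphereLaw at hgood ⊢
  have hmp := pi_update_mp (fun _ : Fin p => uniformSphere n) j
  have hgood2 := Measure.ae_ae_of_ae_prod (hmp.quasiMeasurePreserving.ae hgood)
  set S := ∑ k, a k ^ 2 with hS
  have hdm : ∀ k l, Measurable fun ω : Fin p → Fin n → ℝ => delRow (rowMat A ω i) ⟨j, hj⟩ k l :=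
    fun k l => meas_rowMat A i k.1 l
  have hFm : Measurable fun ω : Fin p → Fin n → ℝ => (trA a (projB (rowMat A ω i)) -
      (trA a (projB (delRow (rowMat A ω i) ⟨j, hj⟩)) - 1)) ^ 2 :=
    ((trA_meas a _ (meas_rowMat A i)).sub ((trA_meas a _ hdm).sub measurable_const)).pow_const 2
  have hFb : ∀ ω : Fin p → Fin n → ℝ, |(trA a (projB (rowMat A ω i)) -
      (trA a (projB (delRow (rowMat A ω i) ⟨j, hj⟩)) - 1)) ^ 2| ≤ (S + (S + 1)) ^ 2 := by
    intro ω
    rw [abs_pow]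
    refine pow_le_pow_left₀ (abs_nonneg _) ?_ 2
    refine (abs_sub _ _).trans (add_le_add (trA_bound a _) ?_)
    refine (abs_sub _ _).trans (add_le_add (trA_bound a _) (by simp))
  rw [pi_integral_update _ j _ hFm _ hFb]
  have hmain : ∀ᵐ ω ∂(Measure.pi fun _ : Fin p => uniformSphere n),
      ∫ x, (trA a (projB (rowMat A (Function.update ω j x) i)) -
      (trA a (projB (delRow (rowMat A (Function.update ω j x) i) ⟨j, hj⟩)) - 1)) ^ 2
        ∂(uniformSphere n) ≤ C ^ 2 * (∑ k, (a k ^ 2 - 1) ^ 2) / (n - i) := by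
    filter_upwards [hgood, hgood2] with ω hω hω2
    set B' := delRow (rowMat A ω i) ⟨j, hj⟩ with hB'
    have hu : IsUnit (B' * B'ᵀ).det :=
      gram_unit_submatrix _ _ Subtype.val_injective hω
    have hcard : Fintype.card {k : Fin i // k ≠ ⟨j, hj⟩} ≤ i := by
      simpa using Fintype.card_subtype_le (fun k : Fin i => k ≠ ⟨j, hj⟩)
    set M := projB B' * A with hM
    have hMv : ∀ x, projB B' *ᵥ (A *ᵥ x) = M *ᵥ x := fun x => Matrix.mulVec_mulVec _ _ _
    have mr : ∀ l, Measurable fun x : Fin n → ℝ =>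
        ((M *ᵥ x) l) ^ 2 / ((M *ᵥ x) ⬝ᵥ (M *ᵥ x)) := by
      intro l
      unfold mulVec dotProduct
      fun_prop
    have dn : ∀ z : Fin n → ℝ, 0 ≤ z ⬝ᵥ z := fun z => by
      simp only [dotProduct]; exact Finset.sum_nonneg fun k _ => mul_self_nonneg _
    have ir : ∀ l, Integrable (fun x : Fin n → ℝ =>
        ((M *ᵥ x) l) ^ 2 / ((M *ᵥ x) ⬝ᵥ (M *ᵥ x))) (uniformSphere n) := by
      intro l
      refine bdd_integrable _ (mr l) (M := 1) fun x => ?_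
      rw [abs_of_nonneg (div_nonneg (sq_nonneg _) (dn _))]
      refine div_le_one_of_le₀ ?_ (dn _)
      simp only [dotProduct, ← sq]
      exact Finset.single_le_sum (f := fun b => ((M *ᵥ x) b) ^ 2) (fun _ _ => sq_nonneg _)
        (Finset.mem_univ l)
    have hpt : ∀ᵐ x ∂(uniformSphere n),
        (trA a (projB (rowMat A (Function.update ω j x) i)) -
        (trA a (projB (delRow (rowMat A (Function.update ω j x) i) ⟨j, hj⟩)) - 1)) ^ 2 ≤
        ∑ l, (a l ^ 2 - 1) ^ 2 * (((M *ᵥ x) l) ^ 2 / ((M *ᵥ x) ⬝ᵥ (M *ᵥ x))) := by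
      filter_upwards [hω2] with x hx
      have := downdate_ineq a _ (⟨j, hj⟩ : Fin i) hx
      rw [rowMat_update_self A ω i j x ⟨j, hj⟩ rfl] at this
      rw [delRow_update, ← hB', hMv] at this
      rw [delRow_update, ← hB']
      exact this
    calc _ ≤ ∫ x, ∑ l, (a l ^ 2 - 1) ^ 2 * (((M *ᵥ x) l) ^ 2 / ((M *ᵥ x) ⬝ᵥ (M *ᵥ x)))
            ∂(uniformSphere n) :=
          integral_mono_of_nonneg (Eventually.of_forall fun x => sq_nonneg _)
            (integrable_finsetSum _ fun l _ => (ir l).const_mul _) hpt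
      _ = ∑ l, (a l ^ 2 - 1) ^ 2 * ∫ x, (((M *ᵥ x) l) ^ 2 / ((M *ᵥ x) ⬝ᵥ (M *ᵥ x)))
            ∂(uniformSphere n) := by
          rw [integral_finsetSum _ fun l _ => (ir l).const_mul _]
          exact Finset.sum_congr rfl fun l _ => integral_const_mul _ _
      _ ≤ ∑ l, (a l ^ 2 - 1) ^ 2 * (C ^ 2 / (n - i)) := by
          refine Finset.sum_le_sum fun l _ => mul_le_mul_of_nonneg_left ?_ (sq_nonneg _)
          rw [sphere_ratio]
          have hb := gauss_bound a C hC ha B' hu (by omega) l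
          simp only [← hA, hMv] at hb
          refine hb.trans ?_
          have : (Fintype.card {k : Fin i // k ≠ ⟨j, hj⟩} : ℝ) ≤ i := by exact_mod_cast hcard
          gcongr
      _ = _ := by rw [← Finset.sum_mul]; ring
  calc _ ≤ ∫ ω, C ^ 2 * (∑ k, (a k ^ 2 - 1) ^ 2) / (n - i)
        ∂(Measure.pi fun _ : Fin p => uniformSphere n) :=
        integral_mono_of_nonneg (Eventually.of_forall fun ω => integral_nonneg fun x => sq_nonneg _)
          (integrable_const _) hmain
    _ = _ := by simp

lemma var_bound {n p : ℕ} (hp : p ≤ n) (a : Fin n → ℝ) (C : ℝ) (hC : 1 ≤ C)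
    (ha : ∀ k, C⁻¹ ≤ a k ^ 2 ∧ a k ^ 2 ≤ C) (i : ℕ) (hi : i < p) :
    ∫ ω, (trA a (projB (rowMat (diagonal a) ω i))) ^ 2 ∂(sphereLaw n p)
      - (∫ ω, trA a (projB (rowMat (diagonal a) ω i)) ∂(sphereLaw n p)) ^ 2
      ≤ i * (C ^ 2 * (∑ k, (a k ^ 2 - 1) ^ 2) / (n - i)) := by
  set A := diagonal a with hA
  set S := ∑ k, a k ^ 2 with hS
  have hE := efron_stein (uniformSphere n) p (fun ω => trA a (projB (rowMat A ω i)))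
    (fun j ω => if hj : (j : ℕ) < i then trA a (projB (delRow (rowMat A ω i) ⟨j, hj⟩)) - 1
      else trA a (projB (rowMat A ω i))) (S + 1)
    (trA_meas a _ (meas_rowMat A i))
    (fun ω => (trA_bound a _).trans (by linarith))
    (fun j => by
      split_ifs with hj
      · exact (trA_meas a (fun ω : Fin p → Fin n → ℝ => delRow (rowMat A ω i) ⟨j, hj⟩)
          (fun k l => meas_rowMat A i k.1 l)).sub measurable_const
      · exact trA_meas a _ (meas_rowMat A i))
    (fun j ω => by
      split_ifs with hj
      · exact (abs_sub _ _).trans (add_le_add (trA_bound a _) (by simp))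
      · exact (trA_bound a _).trans (by linarith))
    (fun j ω x => by
      split_ifs with hj
      · rw [delRow_update]
      · have : rowMat A (Function.update ω j x) i = rowMat A ω i := by
          ext k l
          exact congrFun (rowMat_update A ω i j x k (by have := k.2; omega)) l
        rw [this])
  refine le_trans hE ?_
  have hni : (0 : ℝ) < n - i := by
    have : (i : ℝ) < n := by exact_mod_cast (by omega : i < n)
    linarith
  set K := C ^ 2 * (∑ k, (a k ^ 2 - 1) ^ 2) / (n - i) with hK
  calc _ ≤ ∑ j : Fin p, if (j : ℕ) < i then K else 0 := by
        refine Finset.sum_le_sum fun j _ => ?_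
        split_ifs with hj
        · exact coord_bound hp a C hC ha i hi j hj
        · simp
    _ = i * K := by
        rw [← Finset.sum_filter, Finset.sum_const, nsmul_eq_mul]
        congr 2
        rw [Fin.card_filter_val_lt]
        omega


lemma l1_bound {X : Type*} [MeasurableSpace X] (μ : Measure X) [IsProbabilityMeasure μ]
    {g : X → ℝ} (hg : Measurable g) {M : ℝ} (hM : ∀ x, |g x| ≤ M) (h1 : ∫ x, g x ∂μ = 1)
    (s : ℝ) (hs : 0 < s) (hV : ∫ x, (g x) ^ 2 ∂μ - 1 ≤ s ^ 2) :
    ∫ x, |(g x) ^ 2 - ∫ y, (g y) ^ 2 ∂μ| ∂μ ≤ 2 * s ^ 2 + 2 * s := by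
  have i1 := bdd_integrable μ hg hM
  have i2 : Integrable (fun x => g x ^ 2) μ :=
    bdd_integrable μ (hg.pow_const 2) (M := M ^ 2) fun x => by
      rw [abs_pow]; exact pow_le_pow_left₀ (abs_nonneg _) (hM x) 2
  have hve := var_eq μ hg hM
  rw [h1] at hve
  have hW0 : 0 ≤ ∫ x, (g x - 1) ^ 2 ∂μ := integral_nonneg fun x => sq_nonneg _
  have i3 : Integrable (fun x => (g x - 1) ^ 2) μ := by
    have : (fun x => (g x - 1) ^ 2) = fun x => g x ^ 2 - 2 * g x + 1 := by
      funext x; ring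
    rw [this]
    exact (i2.sub (i1.const_mul 2)).add (integrable_const _)
  set W := ∫ y, (g y) ^ 2 ∂μ with hWd
  have hpt : ∀ x, |g x ^ 2 - W| ≤ (1 + 1 / s) * (g x - 1) ^ 2 + (s + (W - 1)) := by
    intro x
    have e : 2 * |g x - 1| ≤ 1 / s * (g x - 1) ^ 2 + s := by
      rw [← sq_abs (g x - 1)]
      have := sq_nonneg (|g x - 1| - s)
      have h2 : 1 / s * |g x - 1| ^ 2 + s = (|g x - 1| ^ 2 + s ^ 2) / s := by field_simp
      rw [h2, le_div_iff₀ hs]; nlinarith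
    have e1 := le_abs_self (g x - 1)
    have e2 := neg_abs_le (g x - 1)
    have e3 : 0 ≤ W - 1 := by nlinarith
    rw [abs_le]; constructor <;> nlinarith [sq_nonneg (g x - 1)]
  have hI : ∫ x, |(g x) ^ 2 - W| ∂μ ≤ ∫ x, ((1 + 1 / s) * (g x - 1) ^ 2 + (s + (W - 1))) ∂μ :=
    integral_mono (i2.sub (integrable_const W)).abs
      ((i3.const_mul _).add (integrable_const _)) hpt
  rw [integral_add (i3.const_mul _) (integrable_const _), integral_const_mul, hve] at hI
  simp only [integral_const, probReal_univ, one_smul] at hI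
  have h4 : 1 / s * (W - 1) ≤ s := by
    rw [one_div, inv_mul_le_iff₀ hs]; nlinarith
  nlinarith

lemma Tstat_eq {n p : ℕ} (a : Fin n → ℝ) (i : ℕ) :
    Tstat n p (diagonal a) i
      = ∫ ω, trA a (projB (rowMat (diagonal a) ω i)) ∂(sphereLaw n p) := by
  unfold Tstat
  rw [trA_eq1]
  unfold trA
  rw [integral_finsetSum]
  · refine Finset.sum_congr rfl fun k _ => ?_
    rw [integral_const_mul]; rfl
  · intro k _
    refine Integrable.const_mul ?_ _
    refine bdd_integrable _ (meas_projB _ (fun _ _ => meas_rowMat _ _ _ _) k k) (M := 1) fun ω => ?_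
    rw [abs_of_nonneg (projB_diag_nonneg _ k)]
    exact projB_diag_le _ k

lemma traceQ_eq {n p : ℕ} (a : Fin n → ℝ) (i : ℕ) (ω : Fin p → Fin n → ℝ) :
    Matrix.trace (Qmat (diagonal a) ω i)
      = (Tstat n p (diagonal a) i)⁻¹ * trA a (projB (rowMat (diagonal a) ω i)) := by
  unfold Qmat
  rw [Matrix.trace_smul, trA_eq2]; rfl

lemma trA_ge {n : ℕ} {ι : Type*} [Fintype ι] [DecidableEq ι] (a : Fin n → ℝ) (c : ℝ) (hc : 0 ≤ c)
    (ha : ∀ k, c ≤ a k ^ 2) (B : Matrix ι (Fin n) ℝ) :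
    c * ((n : ℝ) - Fintype.card ι) ≤ trA a (projB B) := by
  calc c * ((n : ℝ) - Fintype.card ι) ≤ c * (projB B).trace :=
        mul_le_mul_of_nonneg_left (projB_trace_ge B) hc
    _ = ∑ k, c * projB B k k := by rw [Matrix.trace, Finset.mul_sum]; rfl
    _ ≤ _ := Finset.sum_le_sum fun k _ =>
        mul_le_mul_of_nonneg_right (ha k) (projB_diag_nonneg B k)

lemma finite_bound {n p : ℕ} (hp : p ≤ n) (hn : 0 < n) (a : Fin n → ℝ) (C : ℝ) (hC : 1 ≤ C)
    (ha : ∀ k, C⁻¹ ≤ a k ^ 2 ∧ a k ^ 2 ≤ C) (c : ℝ) (hc : 0 < c) (hc1 : c ≤ 1)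
    (hcn : c * n ≤ (n : ℝ) - p) (η : ℝ) (hη : 0 < η) (hδ : ∑ k, (a k ^ 2 - 1) ^ 2 ≤ η) :
    Integrable (fun ω => ∑ i ∈ Finset.range p, ((Matrix.trace (Qmat (diagonal a) ω i)) ^ 2
       - ∫ ω', (Matrix.trace (Qmat (diagonal a) ω' i)) ^ 2 ∂(sphereLaw n p))) (sphereLaw n p) ∧
    ∫ ω, |∑ i ∈ Finset.range p, ((Matrix.trace (Qmat (diagonal a) ω i)) ^ 2
       - ∫ ω', (Matrix.trace (Qmat (diagonal a) ω' i)) ^ 2 ∂(sphereLaw n p))| ∂(sphereLaw n p)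
      ≤ 2 * (C ^ 2 / c ^ 2) ^ 2 * η + 2 * (C ^ 2 / c ^ 2) * √η := by
  have hn' : (0 : ℝ) < n := by exact_mod_cast hn
  have hn1 : (1 : ℝ) ≤ n := by exact_mod_cast hn
  have hC0 : 0 < C := by linarith
  set K := C ^ 2 / c ^ 2 with hK
  have hK0 : 0 < K := by positivity
  set s := K * √η / n with hs
  have hs0 : 0 < s := by positivity
  have hs2 : s ^ 2 = K ^ 2 * η / n ^ 2 := by
    rw [hs, div_pow, mul_pow, Real.sq_sqrt hη.le]
  have hpn : (p : ℝ) ≤ n := by exact_mod_cast hp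
  have key : ∀ i ∈ Finset.range p,
      Measurable (fun ω : Fin p → Fin n → ℝ => Matrix.trace (Qmat (diagonal a) ω i)) ∧
      (∃ M, ∀ ω : Fin p → Fin n → ℝ, |Matrix.trace (Qmat (diagonal a) ω i)| ≤ M) ∧
      ∫ ω, |(Matrix.trace (Qmat (diagonal a) ω i)) ^ 2
       - ∫ ω', (Matrix.trace (Qmat (diagonal a) ω' i)) ^ 2 ∂(sphereLaw n p)| ∂(sphereLaw n p)
        ≤ 2 * s ^ 2 + 2 * s := by
    intro i hi
    have hi := Finset.mem_range.1 hi
    have hip : (i : ℝ) ≤ p := by exact_mod_cast hi.le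
    have hvb := var_bound hp a C hC ha i hi
    simp only [traceQ_eq]
    rw [← Tstat_eq] at hvb
    have hfm : Measurable fun ω : Fin p → Fin n → ℝ => trA a (projB (rowMat (diagonal a) ω i)) :=
      trA_meas a _ fun _ _ => meas_rowMat _ _ _ _
    have hfb : ∀ ω : Fin p → Fin n → ℝ, |trA a (projB (rowMat (diagonal a) ω i))| ≤ ∑ k, a k ^ 2 :=
      fun ω => trA_bound a _
    have hTge : C⁻¹ * (c * n) ≤ Tstat n p (diagonal a) i := by
      rw [Tstat_eq]
      have : ∫ _ω : Fin p → Fin n → ℝ, C⁻¹ * (c * n) ∂(sphereLaw n p)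
          ≤ ∫ ω, trA a (projB (rowMat (diagonal a) ω i)) ∂(sphereLaw n p) := by
        refine integral_mono (integrable_const _) (bdd_integrable _ hfm hfb) fun ω => ?_
        refine le_trans ?_ (trA_ge a C⁻¹ (by positivity) (fun k => (ha k).1) _)
        refine mul_le_mul_of_nonneg_left ?_ (by positivity)
        simp only [Fintype.card_fin]; linarith
      simpa using this
    have hTe := Tstat_eq (p := p) a i
    set T := Tstat n p (diagonal a) i with hT
    have hT1 : 0 < C⁻¹ * (c * n) := by positivity
    have hT0 : 0 < T := lt_of_lt_of_le hT1 hTge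
    have hgm := hfm.const_mul T⁻¹
    have hgb : ∀ ω : Fin p → Fin n → ℝ, |T⁻¹ * trA a (projB (rowMat (diagonal a) ω i))|
        ≤ T⁻¹ * ∑ k, a k ^ 2 := fun ω => by
      rw [abs_mul, abs_of_pos (inv_pos.2 hT0)]
      exact mul_le_mul_of_nonneg_left (hfb ω) (inv_pos.2 hT0).le
    refine ⟨hgm, ⟨_, hgb⟩, l1_bound _ hgm hgb ?_ s hs0 ?_⟩
    · rw [integral_const_mul, ← hTe, inv_mul_cancel₀ hT0.ne']
    · simp only [mul_pow]
      rw [integral_const_mul]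
      set F := ∫ ω, (trA a (projB (rowMat (diagonal a) ω i))) ^ 2 ∂(sphereLaw n p)
      have e : (T⁻¹) ^ 2 * F - 1 = (F - T ^ 2) / T ^ 2 := by field_simp
      rw [e, div_le_iff₀ (by positivity), hs2]
      have hni : c * n ≤ (n : ℝ) - i := by linarith
      have hcn0 : 0 < c * n := by positivity
      have b1 : (i : ℝ) * (C ^ 2 * (∑ k, (a k ^ 2 - 1) ^ 2) / (n - i))
          ≤ n * (C ^ 2 * η / (c * n)) := by
        have hin : (i : ℝ) ≤ n := hip.trans hpn
        have q1 : 0 < (n : ℝ) - i := by linarith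
        have q0 : 0 ≤ ∑ k, (a k ^ 2 - 1) ^ 2 := Finset.sum_nonneg fun k _ => sq_nonneg _
        refine mul_le_mul hin ?_ (by positivity) hn'.le
        exact div_le_div₀ (by positivity) (mul_le_mul_of_nonneg_left hδ (by positivity)) hcn0 hni
      have b2 : (n : ℝ) * (C ^ 2 * η / (c * n)) = C ^ 2 * η / c := by field_simp
      have b3 : K ^ 2 * η / n ^ 2 * (C⁻¹ * (c * n)) ^ 2 ≤ K ^ 2 * η / n ^ 2 * T ^ 2 := by
        gcongr
      have b4 : K ^ 2 * η / n ^ 2 * (C⁻¹ * (c * n)) ^ 2 = C ^ 2 * η / c ^ 2 := by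
        rw [hK]; field_simp
      have b5 : C ^ 2 * η / c ≤ C ^ 2 * η / c ^ 2 := by
        gcongr
        nlinarith
      linarith
  have hintg : ∀ i ∈ Finset.range p, Integrable (fun ω => (Matrix.trace (Qmat (diagonal a) ω i)) ^ 2
       - ∫ ω', (Matrix.trace (Qmat (diagonal a) ω' i)) ^ 2 ∂(sphereLaw n p)) (sphereLaw n p) := by
    intro i hi
    obtain ⟨h1, ⟨M, hM⟩, -⟩ := key i hi
    refine Integrable.sub ?_ (integrable_const _)
    refine bdd_integrable _ (h1.pow_const 2) (M := M ^ 2) fun x => ?_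
    rw [abs_pow]; exact pow_le_pow_left₀ (abs_nonneg _) (hM x) 2
  refine ⟨integrable_finsetSum _ hintg, ?_⟩
  calc _ ≤ ∫ ω, ∑ i ∈ Finset.range p, |(Matrix.trace (Qmat (diagonal a) ω i)) ^ 2
       - ∫ ω', (Matrix.trace (Qmat (diagonal a) ω' i)) ^ 2 ∂(sphereLaw n p)| ∂(sphereLaw n p) :=
        integral_mono (integrable_finsetSum _ hintg).abs
          (integrable_finsetSum _ fun i hi => (hintg i hi).abs)
          fun ω => Finset.abs_sum_le_sum_abs _ _
    _ = ∑ i ∈ Finset.range p, ∫ ω, |(Matrix.trace (Qmat (diagonal a) ω i)) ^ 2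
       - ∫ ω', (Matrix.trace (Qmat (diagonal a) ω' i)) ^ 2 ∂(sphereLaw n p)| ∂(sphereLaw n p) :=
        integral_finsetSum _ fun i hi => (hintg i hi).abs
    _ ≤ ∑ i ∈ Finset.range p, (2 * s ^ 2 + 2 * s) := Finset.sum_le_sum fun i hi => (key i hi).2.2
    _ = p * (2 * s ^ 2 + 2 * s) := by simp [mul_add]
    _ ≤ n * (2 * s ^ 2 + 2 * s) := by gcongr
    _ = 2 * (K ^ 2 * η) / n + 2 * K * √η := by rw [hs2, hs]; field_simp
    _ ≤ _ := by
      have : 2 * (K ^ 2 * η) / n ≤ 2 * (K ^ 2 * η) := div_le_self (by positivity) hn1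
      linarith


/-- Under Assumptions (A) and (B), the sum
`∑_{i=0}^{p−1} ((tr(Q_i))² − E[(tr(Q_i))²])` converges to `0` in probability as `n → ∞`. -/
theorem sum_traceQ_sq_centered_tendsto_zero (p : ℕ → ℕ) (γ : ℝ)
    (A : ∀ n, Matrix (Fin n) (Fin n) ℝ)
    (hp : ∀ n, p n ≤ n)
    (hdiag : ∀ n, (A n).IsDiag) (hpos : ∀ n k, 0 < A n k k)
    (htr : ∀ n, Matrix.trace (A n * A n) = (n : ℝ))
    (hγ : 0 < γ ∧ γ < 1)
    (hA : Tendsto (fun n => (p n : ℝ) / (n : ℝ)) atTop (𝓝 γ))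
    (C : ℝ) (hC : 1 ≤ C)
    (hCb : ∀ n k, C⁻¹ ≤ (A n k k) ^ 2 ∧ (A n k k) ^ 2 ≤ C)
    (hB2 : Tendsto
      (fun n => Matrix.trace
        ((A n * A n - (Matrix.trace (A n * A n) / (n : ℝ)) • (1 : Matrix (Fin n) (Fin n) ℝ)) ^ 2))
      atTop (𝓝 0)) :
    ∀ ε : ℝ, 0 < ε →
      Tendsto (fun n => sphereLaw n (p n)
          {ω | ε < |∑ i ∈ Finset.range (p n),
            ((Matrix.trace (Qmat (A n) ω i)) ^ 2
              - ∫ ω', (Matrix.trace (Qmat (A n) ω' i)) ^ 2 ∂(sphereLaw n (p n)))|})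
        atTop (𝓝 0) := by
  intro ε hε
  set c := (1 - γ) / 2 with hc
  have hc0 : 0 < c := by rw [hc]; linarith [hγ.2]
  have hc1 : c ≤ 1 := by rw [hc]; linarith [hγ.1]
  set δ : ℕ → ℝ := fun n => ∑ k, ((A n k k) ^ 2 - 1) ^ 2 with hδ
  have hAd : ∀ n, A n = diagonal fun k => A n k k := fun n => ((hdiag n).diagonal_diag).symm
  have hδ0 : Tendsto δ atTop (𝓝 0) := by
    refine hB2.congr' ?_
    filter_upwards [eventually_gt_atTop 0] with n hn
    have hn' : (n : ℝ) ≠ 0 := by exact_mod_cast hn.ne'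
    rw [htr n, div_self hn', one_smul, hδ]
    have : A n * A n - 1 = diagonal fun k => (A n k k) ^ 2 - 1 := by
      conv_lhs => rw [hAd n, Matrix.diagonal_mul_diagonal, ← Matrix.diagonal_one,
        Matrix.diagonal_sub]
      simp only [sq]
    rw [this, Matrix.diagonal_pow, Matrix.trace_diagonal]
    rfl
  set η : ℕ → ℝ := fun n => δ n + 1 / (n : ℝ) with hη
  have hη0 : Tendsto η atTop (𝓝 0) := by
    have := hδ0.add (tendsto_one_div_atTop_nhds_zero_nat (𝕜 := ℝ))
    rwa [add_zero] at this
  set R : ℕ → ℝ := fun n => 2 * (C ^ 2 / c ^ 2) ^ 2 * η n + 2 * (C ^ 2 / c ^ 2) * √(η n) with hR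
  have hR0 : Tendsto R atTop (𝓝 0) := by
    have h1 := (hη0.const_mul (2 * (C ^ 2 / c ^ 2) ^ 2)).add
      (((Real.continuous_sqrt.tendsto 0).comp hη0).const_mul (2 * (C ^ 2 / c ^ 2)))
    simpa using h1
  have hlim : Tendsto (fun n => ENNReal.ofReal (R n / ε)) atTop (𝓝 0) := by
    have := ENNReal.tendsto_ofReal (hR0.div_const ε)
    simpa using this
  refine tendsto_of_tendsto_of_tendsto_of_le_of_le' tendsto_const_nhds hlim
    (Eventually.of_forall fun _ => zero_le) ?_
  have hev : ∀ᶠ n in atTop, (p n : ℝ) / n < 1 - c :=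
    hA.eventually_lt_const (by rw [hc]; linarith [hγ.2])
  filter_upwards [hev, eventually_gt_atTop 0] with n h1 hn
  have hn' : (0 : ℝ) < n := by exact_mod_cast hn
  have hcn : c * n ≤ (n : ℝ) - p n := by
    rw [div_lt_iff₀ hn'] at h1; linarith
  have hδn : 0 ≤ δ n := Finset.sum_nonneg fun k _ => sq_nonneg _
  have hηn : 0 < η n := by have : 0 < 1 / (n : ℝ) := by positivity
                           simp only [hη]; linarith
  have hle : ∑ k, ((A n k k) ^ 2 - 1) ^ 2 ≤ η n := by
    have : 0 < 1 / (n : ℝ) := by positivity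
    simp only [hη, hδ]; linarith
  obtain ⟨hi, hb⟩ := finite_bound (hp n) hn (fun k => A n k k) C hC (hCb n) c hc0 hc1 hcn (η n)
    hηn hle
  rw [← hAd n] at hi hb
  have hmk := mul_meas_ge_le_integral_of_nonneg (Eventually.of_forall fun ω => abs_nonneg _)
    hi.abs ε
  have hmk2 := (hmk.trans hb)
  set S := {ω | ε < |∑ i ∈ Finset.range (p n),
            ((Matrix.trace (Qmat (A n) ω i)) ^ 2
              - ∫ ω', (Matrix.trace (Qmat (A n) ω' i)) ^ 2 ∂(sphereLaw n (p n)))|} with hS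
  have hsub : S ⊆ {ω | ε ≤ |∑ i ∈ Finset.range (p n),
            ((Matrix.trace (Qmat (A n) ω i)) ^ 2
              - ∫ ω', (Matrix.trace (Qmat (A n) ω' i)) ^ 2 ∂(sphereLaw n (p n)))|} :=
    fun ω hω => le_of_lt (Set.mem_setOf_eq ▸ hω)
  refine (measure_mono hsub).trans ?_
  rw [← ENNReal.ofReal_toReal (measure_ne_top (sphereLaw n (p n)) _)]
  refine ENNReal.ofReal_le_ofReal ?_
  rw [le_div_iff₀ hε, mul_comm]
  exact hmk2
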